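/- Suppose Φ is simply laced and let S ⊆ Ψ be an orthogonal subset. Then Φ_S = S ∪ (−S). -/

import Mathlib

open scoped RealInnerProductSpace
open Classical

noncomputable section

variable (V : Type) [NormedAddCommGroup V] [InnerProductSpace ℝ V]

/-- The reflection determined by a vector `α` (the identity map if `α = 0`),
as a linear endomorphism:  `x ↦ x - (2⟪x,α⟫/⟪α,α⟫) • α`. -/
def reflMap (α : V) : V →ₗ[ℝ] V where
  toFun x := x - (2 * ⟪x, α⟫ / ⟪α, α⟫) • α
  map_add' x y := by
    simp only [inner_add_left]
    rw [show 2 * (⟪x, α⟫ + ⟪y, α⟫) / ⟪α, α⟫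
        = 2 * ⟪x, α⟫ / ⟪α, α⟫ + 2 * ⟪y, α⟫ / ⟪α, α⟫ by ring, add_smul]
    abel
  map_smul' c x := by
    simp only [real_inner_smul_left, RingHom.id_apply, smul_sub]
    rw [show 2 * (c * ⟪x, α⟫) / ⟪α, α⟫ = c * (2 * ⟪x, α⟫ / ⟪α, α⟫) by ring,
      mul_smul]

lemma reflMap_apply (α x : V) :
    reflMap V α x = x - (2 * ⟪x, α⟫ / ⟪α, α⟫) • α := rfl

lemma reflMap_involutive (α : V) : ∀ x, reflMap V α (reflMap V α x) = x := by
  intro x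
  by_cases h : (⟪α, α⟫ : ℝ) = 0
  · have h0 : α = 0 := inner_self_eq_zero.mp h
    simp [reflMap_apply, h0]
  · rw [reflMap_apply, reflMap_apply, inner_sub_left, real_inner_smul_left,
      div_mul_cancel₀ _ h]
    rw [show ⟪x, α⟫ - 2 * ⟪x, α⟫ = -⟪x, α⟫ by ring]
    rw [show 2 * -⟪x, α⟫ / ⟪α, α⟫ = -(2 * ⟪x, α⟫ / ⟪α, α⟫) by ring, neg_smul]
    abel

/-- The reflection determined by a vector `α`, as a linear automorphism of `V`. -/
def sref (α : V) : V ≃ₗ[ℝ] V :=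
  { reflMap V α with
    invFun := reflMap V α
    left_inv := reflMap_involutive V α
    right_inv := reflMap_involutive V α }

lemma sref_apply (α x : V) :
    sref V α x = x - (2 * ⟪x, α⟫ / ⟪α, α⟫) • α := rfl

variable {V}

/-- The coroot `α^∨ = 2α/⟪α,α⟫` associated with a root `α`, under the identification of the
coweight space with `V` given by the inner product. -/
def coroot (α : V) : V := (2 / ⟪α, α⟫) • α

/-- The dimension of the `(-1)`-eigenspace of a linear automorphism. -/
def lamEig (σ : V ≃ₗ[ℝ] V) : ℕ :=
  Module.finrank ℝ (Module.End.eigenspace (σ : V →ₗ[ℝ] V) (-1))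

/-- The action `s_α ∘ σ` of a simple reflection on an involution: `s_α σ` if `s_α` and `σ`
commute, and `s_α σ s_α` otherwise. -/
def circAct (α : V) (σ : V ≃ₗ[ℝ] V) : V ≃ₗ[ℝ] V :=
  if sref V α * σ = σ * sref V α then sref V α * σ else sref V α * σ * sref V α

/-- A set of pairwise orthogonal vectors. -/
def OrthSet (S : Finset V) : Prop :=
  (↑S : Set V).Pairwise fun a b => ⟪a, b⟫ = 0

/-- The product `σ_S` of the (commuting) reflections in the elements of an orthogonal set
`S`. -/
def sigmaOf (S : Finset V) : V ≃ₗ[ℝ] V :=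
  (S.toList.map (sref V)).prod

variable (V)

/-- A finite crystallographic reduced root system in the Euclidean space `V`,
together with a fixed choice of simple roots. -/
structure RSD where
  /-- The set of roots. -/
  Φ : Finset V
  /-- The set of simple roots. -/
  Δ : Finset V
  nonzero : (0 : V) ∉ Φ
  span_top : Submodule.span ℝ (Φ : Set V) = ⊤
  reduced : ∀ α ∈ Φ, ∀ c : ℝ, c • α ∈ Φ → c = 1 ∨ c = -1
  crystal : ∀ α ∈ Φ, ∀ β ∈ Φ, ∃ n : ℤ, (n : ℝ) = 2 * ⟪β, α⟫ / ⟪α, α⟫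
  reflClosed : ∀ α ∈ Φ, ∀ β ∈ Φ, sref V α β ∈ Φ
  Δ_sub : Δ ⊆ Φ
  Δ_indep : LinearIndependent ℝ (fun x : (Δ : Set V) => (x : V))
  Δ_base : ∀ α ∈ Φ, (∃ c : V → ℕ, α = ∑ γ ∈ Δ, (c γ : ℝ) • γ) ∨
      (∃ c : V → ℕ, -α = ∑ γ ∈ Δ, (c γ : ℝ) • γ)

namespace RSD

variable {V}
variable (D : RSD V)

/-- The set of positive roots. -/
def Pos : Set V :=
  {α | α ∈ D.Φ ∧ ∃ c : V → ℕ, α = ∑ γ ∈ D.Δ, (c γ : ℝ) • γ}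

/-- The set of negative roots. -/
def Neg : Set V := {α | -α ∈ D.Pos}

/-- The Weyl group, as the subgroup of `GL(V)` generated by the simple reflections. -/
def W : Subgroup (V ≃ₗ[ℝ] V) := Subgroup.closure ((fun γ => sref V γ) '' ↑D.Δ)

/-- The length of `w`: the least number of simple reflections needed to write `w` as a
product of simple reflections. -/
def length (w : V ≃ₗ[ℝ] V) : ℕ :=
  sInf {n | ∃ l : List V, l.length = n ∧ (∀ γ ∈ l, γ ∈ D.Δ) ∧ w = (l.map (sref V)).prod}

/-- The Bruhat order on the Weyl group: `u ≤ v` iff `v` is obtained from `u` by successively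
multiplying by reflections, each time increasing the length. -/
def ble (u v : V ≃ₗ[ℝ] V) : Prop :=
  Relation.ReflTransGen
    (fun x y => (∃ β ∈ D.Φ, y = sref V β * x) ∧ D.length x < D.length y) u v

/-- The strict Bruhat order. -/
def blt (u v : V ≃ₗ[ℝ] V) : Prop := D.ble u v ∧ u ≠ v

/-- The dominance order: `y - x` is a nonnegative integer combination of simple roots. -/
def dom (x y : V) : Prop := ∃ c : V → ℕ, y - x = ∑ γ ∈ D.Δ, (c γ : ℝ) • γ

/-- The dominance order on coweights: `y - x` is a nonnegative integer combination of simple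
coroots. -/
def cdom (x y : V) : Prop := ∃ c : V → ℕ, y - x = ∑ γ ∈ D.Δ, (c γ : ℝ) • coroot γ

/-- The length `L(σ) = (ℓ(σ) + λ(σ))/2` of an involution `σ`, where `λ(σ)` is the dimension
of the `(-1)`-eigenspace of `σ`. -/
def Linv (σ : V ≃ₗ[ℝ] V) : ℚ :=
  ((D.length σ : ℚ) + (lamEig σ : ℚ)) / 2

end RSD

/-- A finite irreducible crystallographic reduced root system, with a fixed choice of simple
roots and a marked simple root `αP` whose coefficient in the highest root `θ` equals `1`
(the cominuscule case). -/
structure MRSD extends RSD V where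
  irred : ¬ ∃ A B : Set V, A.Nonempty ∧ B.Nonempty ∧ A ∪ B = ↑Φ ∧
      ∀ α ∈ A, ∀ β ∈ B, ⟪α, β⟫ = 0
  /-- The marked simple root. -/
  αP : V
  αP_mem : αP ∈ Δ
  /-- The highest root. -/
  θ : V
  θ_mem : θ ∈ Φ
  θ_high : ∀ α ∈ Φ, ∃ c : V → ℕ, θ - α = ∑ γ ∈ Δ, (c γ : ℝ) • γ
  θ_coeff : ∃ c : V → ℕ, (θ = ∑ γ ∈ Δ, (c γ : ℝ) • γ) ∧ c αP = 1

namespace MRSD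

variable {V}
variable (M : MRSD V)

/-- The set `Ψ` of positive roots in which the marked simple root `αP` has coefficient `1`. -/
def Psi : Set V :=
  {α | α ∈ M.Φ ∧ ∃ c : V → ℕ, (α = ∑ γ ∈ M.Δ, (c γ : ℝ) • γ) ∧ c M.αP = 1}

/-- The set of positive roots of the subsystem `Φ_P`, i.e. the positive roots in which the
marked simple root `αP` has coefficient `0`. -/
def PosP : Set V :=
  {α | α ∈ M.Φ ∧ ∃ c : V → ℕ, (α = ∑ γ ∈ M.Δ, (c γ : ℝ) • γ) ∧ c M.αP = 0}

/-- The parabolic subgroup `W_P` generated by the simple reflections in `Δ ∖ {αP}`. -/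
def WP : Subgroup (V ≃ₗ[ℝ] V) :=
  Subgroup.closure ((fun γ => sref V γ) '' ↑(M.Δ.erase M.αP))

/-- The inversion set `Φ⁺(v) = {α ∈ Φ⁺ : v(α) ∈ Φ⁻}`. -/
def InvSet (v : V ≃ₗ[ℝ] V) : Set V := {α | α ∈ M.Pos ∧ v α ∈ M.Neg}

/-- `v` belongs to `W^P`: it lies in `W` and has minimal length in its coset `v W_P`. -/
def IsMinRep (v : V ≃ₗ[ℝ] V) : Prop :=
  v ∈ M.W ∧ ∀ u, u ∈ M.W → v⁻¹ * u ∈ M.WP → M.length v ≤ M.length u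

/-- `μ` is the minimal length representative `[w]^P` of the coset `w W_P`. -/
def IsMinRepOf (μ w : V ≃ₗ[ℝ] V) : Prop :=
  (μ ∈ M.W ∧ w⁻¹ * μ ∈ M.WP) ∧
    ∀ u, u ∈ M.W → w⁻¹ * u ∈ M.WP → M.length μ ≤ M.length u

/-- The subset `Φ_S = {α ∈ Φ : σ_S(α) = -α}` determined by an orthogonal set of roots `S`. -/
def PhiSet (S : Finset V) : Set V := {α | α ∈ M.Φ ∧ sigmaOf S α = -α}

/-- A root is long if its squared length is maximal among the roots. -/
def IsLong (α : V) : Prop := ∀ β ∈ M.Φ, ⟪β, β⟫ ≤ ⟪α, α⟫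

/-- Admissible pair: `v ∈ W^P`, `S ⊆ Ψ` a set of pairwise orthogonal roots with
`v(S) ⊆ Φ⁻`. -/
def Admissible (v : V ≃ₗ[ℝ] V) (S : Finset V) : Prop :=
  M.IsMinRep v ∧ (↑S : Set V) ⊆ M.Psi ∧ OrthSet S ∧ ∀ β ∈ S, v β ∈ M.Neg

/-- The length `L(v,S) = (ℓ(σ_{v(S)}) + |S|)/2` of an admissible pair `(v,S)`. -/
def pairL (v : V ≃ₗ[ℝ] V) (S : Finset V) : ℚ :=
  ((M.length (sigmaOf (S.image fun x => v x)) : ℚ) + (S.card : ℚ)) / 2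

end MRSD

section

variable {V}

lemma prod_map_sref_apply (l : List V) (hl : l.Pairwise fun a b => (⟪a, b⟫ : ℝ) = 0) (x : V) :
    (l.map (sref V)).prod x = x - (l.map fun β => (2 * ⟪x, β⟫ / ⟪β, β⟫) • β).sum := by
  induction l generalizing x with
  | nil => simp
  | cons a l ih =>
    rw [List.pairwise_cons] at hl
    have h : ⟪(l.map fun β => (2 * ⟪x, β⟫ / ⟪β, β⟫) • β).sum, a⟫ = 0 := by
      have key : ∀ m : List V, (∀ β ∈ m, (⟪a, β⟫ : ℝ) = 0) →
          ⟪(m.map fun β => (2 * ⟪x, β⟫ / ⟪β, β⟫) • β).sum, a⟫ = 0 := by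
        intro m hm
        induction m with
        | nil => simp
        | cons b m ihm =>
          rw [List.map_cons, List.sum_cons, inner_add_left, real_inner_smul_left,
            real_inner_comm a b, hm b (by simp), ihm fun β hβ => hm β (by simp [hβ])]
          simp
      exact key l hl.1
    rw [List.map_cons, List.prod_cons, LinearEquiv.mul_apply, ih hl.2, sref_apply, inner_sub_left,
      h, sub_zero, List.map_cons, List.sum_cons]
    abel

lemma sigmaOf_apply {S : Finset V} (hS : OrthSet S) (x : V) :
    sigmaOf S x = x - ∑ β ∈ S, (2 * ⟪x, β⟫ / ⟪β, β⟫) • β := by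
  rw [sigmaOf, prod_map_sref_apply, Finset.sum_map_toList]
  refine S.nodup_toList.imp_of_mem fun ha hb hab => hS ?_ ?_ hab
  · simpa using ha
  · simpa using hb

lemma RSD.sigmaOf_mem (D : RSD V) {S : Finset V} (hS : S ⊆ D.Φ) {x : V} (hx : x ∈ D.Φ) :
    sigmaOf S x ∈ D.Φ := by
  have key : ∀ l : List V, (∀ β ∈ l, β ∈ D.Φ) → (l.map (sref V)).prod x ∈ D.Φ := by
    intro l hl
    induction l with
    | nil => simpa using hx
    | cons a l ih =>
      rw [List.map_cons, List.prod_cons, LinearEquiv.mul_apply]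
      exact D.reflClosed a (hl a (by simp)) _ (ih fun β hβ => hl β (by simp [hβ]))
  exact key _ fun β hβ => hS (by simpa using hβ)

lemma RSD.exists_coeff (D : RSD V) {γ : V} (hγ : γ ∈ D.Δ) :
    ∃ f : V →ₗ[ℝ] ℝ, ∀ c : V → ℕ, f (∑ δ ∈ D.Δ, (c δ : ℝ) • δ) = c γ := by
  have hi : LinearIndepOn ℝ id (D.Δ : Set V) := D.Δ_indep
  let b := Module.Basis.extend hi
  have hb : ∀ δ (hδ : δ ∈ D.Δ), b ⟨δ, hi.subset_extend _ hδ⟩ = δ := fun δ hδ => by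
    simp [b]
  refine ⟨b.coord ⟨γ, hi.subset_extend _ hγ⟩, fun c => ?_⟩
  rw [map_sum, Finset.sum_eq_single_of_mem γ hγ]
  · have h : b.coord ⟨γ, hi.subset_extend _ hγ⟩ γ = 1 :=
      (congrArg (b.coord _) (hb γ hγ)).symm.trans (by simp)
    rw [map_smul, h, smul_eq_mul, mul_one]
  · intro δ hδ hne
    conv_lhs => rw [map_smul, ← hb δ hδ]
    simp [hne]

/-- The coefficient of `αP` is linear, equal to `1` on `Ψ` and at most `1` on all roots. -/
lemma MRSD.exists_coeff_αP (M : MRSD V) :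
    ∃ f : V →ₗ[ℝ] ℝ, (∀ β ∈ M.Psi, f β = 1) ∧ ∀ α ∈ M.Φ, f α ≤ 1 := by
  obtain ⟨f, hf⟩ := M.exists_coeff M.αP_mem
  refine ⟨f, ?_, fun α hα => ?_⟩
  · rintro β ⟨-, c, rfl, hc⟩
    simp [hf, hc]
  · obtain ⟨c, hc⟩ := M.θ_high α hα
    obtain ⟨d, hd, hd1⟩ := M.θ_coeff
    have h1 := congrArg f hc
    have h2 := congrArg f hd
    rw [hf, map_sub] at h1
    rw [hf, hd1, Nat.cast_one] at h2
    have : (0 : ℝ) ≤ c M.αP := Nat.cast_nonneg _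
    linarith

lemma OrthSet.mono {S T : Finset V} (hS : OrthSet S) (h : T ⊆ S) : OrthSet T :=
  Set.Pairwise.mono (Finset.coe_subset.2 h) hS

end

/-- Suppose `Φ` is simply laced and `S ⊆ Ψ` is an orthogonal subset.
Then `Φ_S = S ∪ (-S)`. -/
theorem statement15 {V : Type} [NormedAddCommGroup V] [InnerProductSpace ℝ V]
    [FiniteDimensional ℝ V]
    (M : MRSD V) (hsl : ∀ α ∈ M.Φ, ∀ β ∈ M.Φ, (⟪α, α⟫ : ℝ) = ⟪β, β⟫)
    (S : Finset V) (hS : (↑S : Set V) ⊆ M.Psi) (horth : OrthSet S) :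
    M.PhiSet S = {α : V | α ∈ S ∨ -α ∈ S} := by
  have hSΦ : S ⊆ M.Φ := fun β hβ => (hS hβ).1
  have hpos : ∀ α ∈ M.Φ, (0 : ℝ) < ⟪α, α⟫ := fun α hα =>
    real_inner_self_pos.2 fun h => M.nonzero (h ▸ hα)
  have hmem : ∀ β ∈ S, β ∈ M.PhiSet S := by
    intro β hβ
    refine ⟨hSΦ hβ, ?_⟩
    rw [sigmaOf_apply horth, Finset.sum_eq_single_of_mem β hβ,
      mul_div_cancel_right₀ _ (hpos β (hSΦ hβ)).ne', two_smul]
    · abel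
    · intro γ hγ hne
      simp [horth (Finset.mem_coe.2 hβ) (Finset.mem_coe.2 hγ) hne.symm]
  ext α
  constructor
  · rintro ⟨hα, hσ⟩
    obtain ⟨f, hf1, hf⟩ := M.exists_coeff_αP
    set n : V → ℝ := fun β => 2 * ⟪α, β⟫ / ⟪β, β⟫ with hn
    have hinner : ∀ β ∈ S, ⟪α, β⟫ = n β * ⟪α, α⟫ / 2 := by
      intro β hβ
      have := (hpos β (hSΦ hβ)).ne'
      rw [hn, hsl α hα β (hSΦ hβ)]
      field_simp
    have hsum : (2 : ℝ) • α = ∑ β ∈ S, n β • β := by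
      rw [sigmaOf_apply horth] at hσ
      rw [two_smul, eq_comm, ← sub_eq_iff_eq_add, ← neg_sub, hσ, neg_neg]
    have hsq : ∑ β ∈ S, n β ^ 2 = 4 := by
      have h := congrArg (fun v => ⟪α, v⟫) hsum
      simp only [inner_sum, real_inner_smul_right] at h
      rw [Finset.sum_congr rfl fun β hβ => by
        rw [hinner β hβ, show n β * (n β * ⟪α, α⟫ / 2) = n β ^ 2 * (⟪α, α⟫ / 2) by ring],
        ← Finset.sum_mul] at h
      have := hpos α hα
      exact mul_right_cancel₀ (half_pos this).ne' (by linarith)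
    have hfS : ∀ T ⊆ S, f (∑ β ∈ T, n β • β) = ∑ β ∈ T, n β := by
      intro T hT
      rw [map_sum]
      exact Finset.sum_congr rfl fun β hβ => by simp [hf1 β (hS (hT hβ))]
    -- reflecting in the `β` with `n β < 0` makes all coefficients nonnegative
    have habs : ∑ β ∈ S, |n β| ≤ 2 := by
      have hT : S.filter (fun β => n β < 0) ⊆ S := Finset.filter_subset _ _
      have h1 := hf _ (M.sigmaOf_mem (hT.trans hSΦ) hα)
      rw [sigmaOf_apply (horth.mono hT), map_sub, hfS _ hT, Finset.sum_filter] at h1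
      have h2 := congrArg f hsum
      rw [hfS S subset_rfl, map_smul, smul_eq_mul] at h2
      have h3 : ∑ β ∈ S, |n β| = ∑ β ∈ S, n β - 2 * ∑ β ∈ S, if n β < 0 then n β else 0 := by
        rw [Finset.mul_sum, ← Finset.sum_sub_distrib]
        refine Finset.sum_congr rfl fun β _ => ?_
        split_ifs with h
        · rw [abs_of_neg h]; ring
        · rw [abs_of_nonneg (not_lt.1 h)]; ring
      linarith
    have hle : ∀ β ∈ S, |n β| ≤ 2 := fun β hβ =>
      (Finset.single_le_sum (fun γ _ => abs_nonneg (n γ)) hβ).trans habs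
    obtain ⟨β, hβ, h2⟩ : ∃ β ∈ S, |n β| = 2 := by
      have hz : ∀ β ∈ S, |n β| * (2 - |n β|) = 0 := by
        refine (Finset.sum_eq_zero_iff_of_nonneg fun β hβ =>
          mul_nonneg (abs_nonneg _) (sub_nonneg.2 (hle β hβ))).1 (le_antisymm ?_ ?_)
        · simp only [mul_sub, ← pow_two, sq_abs, Finset.sum_sub_distrib, ← Finset.sum_mul, hsq]
          linarith
        · exact Finset.sum_nonneg fun β hβ =>
            mul_nonneg (abs_nonneg _) (sub_nonneg.2 (hle β hβ))
      by_contra! hne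
      have h0 : ∑ β ∈ S, n β ^ 2 = 0 := Finset.sum_eq_zero fun β hβ => by
        have := (mul_eq_zero.1 (hz β hβ)).resolve_right
          (sub_ne_zero.2 (hne β hβ).symm)
        rw [abs_eq_zero.1 this]; norm_num
      linarith
    have hββ := hsl α hα β (hSΦ hβ)
    have hαβ := hinner β hβ
    rcases (abs_eq zero_le_two).1 h2 with h | h <;> rw [h] at hαβ
    · left
      have : α - β = 0 := by
        rw [← inner_self_eq_zero (𝕜 := ℝ), real_inner_sub_sub_self]
        linarith
      rwa [sub_eq_zero.1 this]
    · right
      have : α + β = 0 := by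
        rw [← inner_self_eq_zero (𝕜 := ℝ), real_inner_add_add_self]
        linarith
      rwa [neg_eq_of_add_eq_zero_right this]
  · rintro (h | h)
    · exact hmem α h
    · obtain ⟨h1, h2⟩ := hmem _ h
      refine ⟨?_, ?_⟩
      · have := M.sigmaOf_mem hSΦ h1
        rwa [h2, neg_neg] at this
      · rw [map_neg, neg_neg] at h2
        rw [← h2, neg_neg]
        simp [h2]
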